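/- If the modular grouplike element a equals 1, then u⁻¹ * v = u⁻¹ * (u∘S) = α; in particular u⁻¹ * (u∘S) does not depend on the coquasitriangular structure σ. -/

import Mathlib

open TensorProduct Coalgebra HopfAlgebra

variable {k H : Type*} [Field k] [Ring H] [HopfAlgebra k H]

/-- The antipode of `H`, as a linear map. -/
local notation "𝐒" => HopfAlgebra.antipode (R := k)

/-- Convolution product on the dual of `H`: `(conv f g) h = f h₁ * g h₂`. -/
noncomputable def conv (f g : H →ₗ[k] k) : H →ₗ[k] k :=
  (LinearMap.mul' k k) ∘ₗ (TensorProduct.map f g) ∘ₗ (Coalgebra.comul (R := k))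

/-- `h ↦ f h₁ • h₂`. -/
noncomputable def lT (f : H →ₗ[k] k) : H →ₗ[k] H :=
  (TensorProduct.lid k H).toLinearMap ∘ₗ (f.rTensor H) ∘ₗ (Coalgebra.comul (R := k))

/-- The Sweedler sum `h ↦ f h₁ • p h₃ • g h₂`. -/
noncomputable def sw3 (f : H →ₗ[k] k) (g : H →ₗ[k] H) (p : H →ₗ[k] k) : H →ₗ[k] H :=
  (TensorProduct.lid k H).toLinearMap
    ∘ₗ (TensorProduct.rid k (k ⊗[k] H)).toLinearMap
    ∘ₗ (TensorProduct.map (TensorProduct.map f g) p)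
    ∘ₗ ((Coalgebra.comul (R := k)).rTensor H)
    ∘ₗ (Coalgebra.comul (R := k))

/-- `χ(h) = α(h₂) • S⁻²(h₁)`, the generalized Nakayama automorphism. -/
noncomputable def chiMap (Sinv : H →ₗ[k] H) (f : H →ₗ[k] k) : H →ₗ[k] H :=
  (TensorProduct.rid k H).toLinearMap
    ∘ₗ (TensorProduct.map (Sinv ∘ₗ Sinv) f)
    ∘ₗ (Coalgebra.comul (R := k))

/-- `f(R¹) • R²` for `R = R¹ ⊗ R² ∈ H ⊗ H`. -/
noncomputable def lap (f : H →ₗ[k] k) : (H ⊗[k] H) →ₗ[k] H :=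
  (TensorProduct.lid k H).toLinearMap ∘ₗ (f.rTensor H)

/-- `f(R²) • R¹` for `R = R¹ ⊗ R² ∈ H ⊗ H`. -/
noncomputable def rap (f : H →ₗ[k] k) : (H ⊗[k] H) →ₗ[k] H :=
  (TensorProduct.rid k H).toLinearMap ∘ₗ (LinearMap.lTensor H f)

/-- The Drinfeld element `u = S(R²)R¹`. -/
noncomputable def uElt (Rm : H ⊗[k] H) : H :=
  (LinearMap.mul' k H)
    ((TensorProduct.comm k H H)
      ((LinearMap.lTensor H (HopfAlgebra.antipode (R := k))) Rm))

/-- Convolution product on the dual of `H ⊗ H`. -/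
noncomputable def conv2 (f g : (H ⊗[k] H) →ₗ[k] k) : (H ⊗[k] H) →ₗ[k] k :=
  (LinearMap.mul' k k) ∘ₗ (TensorProduct.map f g) ∘ₗ (Coalgebra.comul (R := k) (A := H ⊗[k] H))

/-- `(h ⊗ l) ↦ σ(h₂ ⊗ l₂) • (l₁ * h₁)`. -/
noncomputable def ac1 (σ : (H ⊗[k] H) →ₗ[k] k) : (H ⊗[k] H) →ₗ[k] H :=
  (TensorProduct.rid k H).toLinearMap
    ∘ₗ (TensorProduct.map ((LinearMap.mul' k H) ∘ₗ (TensorProduct.comm k H H).toLinearMap) σ)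
    ∘ₗ (TensorProduct.tensorTensorTensorComm k H H H H).toLinearMap
    ∘ₗ (TensorProduct.map (Coalgebra.comul (R := k)) (Coalgebra.comul (R := k)))

/-- `(h ⊗ l) ↦ σ(h₁ ⊗ l₁) • (h₂ * l₂)`. -/
noncomputable def ac2 (σ : (H ⊗[k] H) →ₗ[k] k) : (H ⊗[k] H) →ₗ[k] H :=
  (TensorProduct.lid k H).toLinearMap
    ∘ₗ (TensorProduct.map σ (LinearMap.mul' k H))
    ∘ₗ (TensorProduct.tensorTensorTensorComm k H H H H).toLinearMap
    ∘ₗ (TensorProduct.map (Coalgebra.comul (R := k)) (Coalgebra.comul (R := k)))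

/-- `(h ⊗ l) ↦ ρ(h₁ ⊗ l₁) * lam(h₂ * l₂) * τ(h₃ ⊗ l₃)`. -/
noncomputable def trip (lam : H →ₗ[k] k) (ρ τ : (H ⊗[k] H) →ₗ[k] k) : (H ⊗[k] H) →ₗ[k] k :=
  (LinearMap.mul' k k)
    ∘ₗ ((LinearMap.mul' k k).rTensor k)
    ∘ₗ (TensorProduct.map (TensorProduct.map ρ (lam ∘ₗ (LinearMap.mul' k H))) τ)
    ∘ₗ ((TensorProduct.tensorTensorTensorComm k H H H H).toLinearMap.rTensor (H ⊗[k] H))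
    ∘ₗ (TensorProduct.tensorTensorTensorComm k (H ⊗[k] H) H (H ⊗[k] H) H).toLinearMap
    ∘ₗ (TensorProduct.map
          (((Coalgebra.comul (R := k)).rTensor H) ∘ₗ (Coalgebra.comul (R := k)))
          (((Coalgebra.comul (R := k)).rTensor H) ∘ₗ (Coalgebra.comul (R := k))))

/-- `u(h) = σ(h₂ ⊗ S h₁)`. -/
noncomputable def uF (σ : (H ⊗[k] H) →ₗ[k] k) : H →ₗ[k] k :=
  σ ∘ₗ (TensorProduct.comm k H H).toLinearMap
    ∘ₗ ((HopfAlgebra.antipode (R := k)).rTensor H) ∘ₗ (Coalgebra.comul (R := k))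

/-- `v(h) = σ(h₁ ⊗ S h₂)`. -/
noncomputable def vF (σ : (H ⊗[k] H) →ₗ[k] k) : H →ₗ[k] k :=
  σ ∘ₗ (LinearMap.lTensor H (HopfAlgebra.antipode (R := k))) ∘ₗ (Coalgebra.comul (R := k))

/-- `u⁻¹(h) = σ(S²(h₂) ⊗ h₁)`. -/
noncomputable def uinvF (σ : (H ⊗[k] H) →ₗ[k] k) : H →ₗ[k] k :=
  σ ∘ₗ (((HopfAlgebra.antipode (R := k)) ∘ₗ (HopfAlgebra.antipode (R := k))).rTensor H)
    ∘ₗ (TensorProduct.comm k H H).toLinearMap ∘ₗ (Coalgebra.comul (R := k))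

/-- `v⁻¹(h) = σ(S²(h₁) ⊗ h₂)`. -/
noncomputable def vinvF (σ : (H ⊗[k] H) →ₗ[k] k) : H →ₗ[k] k :=
  σ ∘ₗ (((HopfAlgebra.antipode (R := k)) ∘ₗ (HopfAlgebra.antipode (R := k))).rTensor H)
    ∘ₗ (Coalgebra.comul (R := k))


open WithConv

section DualAction

lemma conv_eq_convMul (f g : H →ₗ[k] k) : conv f g = (toConv f * toConv g).ofConv := rfl

lemma conv_apply_repr {ι : Type*} {h : H} (r : Repr k h ι) (f g : H →ₗ[k] k) :
    conv f g h = ∑ i ∈ r.index, f (r.left i) * g (r.right i) :=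
  r.convMul_apply (toConv f) (toConv g)

lemma conv_assoc (f g p : H →ₗ[k] k) : conv (conv f g) p = conv f (conv g p) := by
  simp only [conv_eq_convMul, toConv_ofConv, mul_assoc]

lemma toConv_counit : toConv (Coalgebra.counit (R := k) (A := H)) = 1 := rfl

lemma conv_counit (f : H →ₗ[k] k) : conv f (Coalgebra.counit (R := k)) = f := by
  simp only [conv_eq_convMul, toConv_counit, mul_one, ofConv_toConv]

lemma counit_conv (f : H →ₗ[k] k) : conv (Coalgebra.counit (R := k)) f = f := by
  simp only [conv_eq_convMul, toConv_counit, one_mul, ofConv_toConv]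

/-- `h ↦ f h₂ • h₁`. -/
noncomputable def rT (f : H →ₗ[k] k) : H →ₗ[k] H :=
  rap f ∘ₗ Coalgebra.comul (R := k)

lemma rT_apply_repr {ι : Type*} {h : H} (r : Repr k h ι) (f : H →ₗ[k] k) :
    rT f h = ∑ i ∈ r.index, f (r.right i) • r.left i := by
  simp [rT, rap, ← r.eq]

lemma lT_apply_repr {ι : Type*} {h : H} (r : Repr k h ι) (f : H →ₗ[k] k) :
    lT f h = ∑ i ∈ r.index, f (r.left i) • r.right i := by
  simp [lT, ← r.eq]

lemma apply_rT (f g : H →ₗ[k] k) (h : H) : g (rT f h) = conv g f h := by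
  simp [rT_apply_repr (ℛ k h), conv_apply_repr (ℛ k h), mul_comm]

lemma apply_lT (f g : H →ₗ[k] k) (h : H) : g (lT f h) = conv f g h := by
  simp [lT_apply_repr (ℛ k h), conv_apply_repr (ℛ k h)]

lemma comul_rT (f : H →ₗ[k] k) (h : H) :
    Coalgebra.comul (R := k) (rT f h) = (rT f).lTensor H (Coalgebra.comul h) := by
  have key : Coalgebra.comul (R := k) ∘ₗ rap f =
      (rap f).lTensor H ∘ₗ (TensorProduct.assoc k H H H).toLinearMap ∘ₗ
        (Coalgebra.comul (R := k)).rTensor H := by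
    ext a b
    simp only [rap, ← (ℛ k a).eq, AlgebraTensorModule.curry_apply, LinearMap.restrictScalars_self,
      curry_apply, LinearMap.coe_comp, LinearEquiv.coe_coe, Function.comp_apply,
      LinearMap.lTensor_tmul, TensorProduct.rid_tmul, map_smul, LinearMap.rTensor_tmul,
      TensorProduct.sum_tmul, map_sum, TensorProduct.assoc_tmul, TensorProduct.tmul_smul,
      Finset.smul_sum]
  have := LinearMap.congr_fun key (Coalgebra.comul h)
  simpa [rT, LinearMap.lTensor_comp] using this

lemma comul_lT (f : H →ₗ[k] k) (h : H) :
    Coalgebra.comul (R := k) (lT f h) = (lT f).rTensor H (Coalgebra.comul h) := by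
  have key : Coalgebra.comul (R := k) ∘ₗ lap f =
      (lap f).rTensor H ∘ₗ (TensorProduct.assoc k H H H).symm.toLinearMap ∘ₗ
        (Coalgebra.comul (R := k)).lTensor H := by
    ext a b
    simp only [lap, ← (ℛ k b).eq, AlgebraTensorModule.curry_apply, LinearMap.restrictScalars_self,
      curry_apply, LinearMap.coe_comp, LinearEquiv.coe_coe, Function.comp_apply,
      LinearMap.lTensor_tmul, TensorProduct.lid_tmul, map_smul, LinearMap.rTensor_tmul,
      TensorProduct.tmul_sum, map_sum, TensorProduct.assoc_symm_tmul, TensorProduct.smul_tmul',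
      Finset.smul_sum]
  have := LinearMap.congr_fun key (Coalgebra.comul h)
  have hl : lT f = lap f ∘ₗ Coalgebra.comul (R := k) := rfl
  simpa [hl, LinearMap.rTensor_comp] using this

lemma rT_apply (f : H →ₗ[k] k) (h : H) :
    rT f h = TensorProduct.rid k H (f.lTensor H (Coalgebra.comul h)) := rfl

lemma lT_apply (f : H →ₗ[k] k) (h : H) :
    lT f h = TensorProduct.lid k H (f.rTensor H (Coalgebra.comul h)) := rfl

lemma rT_rT (f g : H →ₗ[k] k) (h : H) : rT f (rT g h) = rT (conv f g) h := by
  have : f ∘ₗ rT g = conv f g := LinearMap.ext fun x => apply_rT g f x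
  rw [rT_apply f, comul_rT, rT_apply (conv f g), ← this, LinearMap.lTensor_comp_apply]

lemma lT_lT (f g : H →ₗ[k] k) (h : H) : lT f (lT g h) = lT (conv g f) h := by
  have : f ∘ₗ lT g = conv g f := LinearMap.ext fun x => apply_lT g f x
  rw [lT_apply f, comul_lT, lT_apply (conv g f), ← this, LinearMap.rTensor_comp_apply]

lemma rT_lT (f g : H →ₗ[k] k) (h : H) : rT f (lT g h) = lT g (rT f h) := by
  rw [← sub_eq_zero, ← Module.forall_dual_apply_eq_zero_iff k]
  intro p
  rw [map_sub, apply_rT, apply_lT, apply_lT, apply_rT, conv_assoc, sub_self]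

lemma rT_counit (h : H) : rT (Coalgebra.counit (R := k)) h = h := by
  simp [rT, rap]

lemma lT_counit (h : H) : lT (Coalgebra.counit (R := k)) h = h := by
  simp [lT]

lemma sw3_id (f p : H →ₗ[k] k) (h : H) : sw3 f LinearMap.id p h = lT f (rT p h) := by
  have key : (TensorProduct.lid k H).toLinearMap
      ∘ₗ (TensorProduct.rid k (k ⊗[k] H)).toLinearMap
      ∘ₗ (TensorProduct.map (TensorProduct.map f LinearMap.id) p)
      ∘ₗ ((Coalgebra.comul (R := k)).rTensor H) = lT f ∘ₗ rap p := by
    ext a b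
    simp [lT, rap, ← (ℛ k a).eq, TensorProduct.sum_tmul, Finset.smul_sum]
  exact LinearMap.congr_fun key (Coalgebra.comul h)

end DualAction

section Antipode

lemma comul_antipode (h : H) :
    Coalgebra.comul (R := k) (𝐒 h) =
      TensorProduct.map 𝐒 𝐒 (TensorProduct.comm k H H (Coalgebra.comul h)) := by
  let i₁ : H →ₐ[k] H ⊗[k] H := Algebra.TensorProduct.includeLeft
  let i₂ : H →ₐ[k] H ⊗[k] H := Algebra.TensorProduct.includeRight
  let s : H →ₗ[k] H := HopfAlgebra.antipode k
  have hδ : toConv (Coalgebra.comul (R := k) (A := H)) =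
      toConv i₁.toLinearMap * toConv i₂.toLinearMap := by
    ext x
    rw [(ℛ k x).convMul_apply]
    simp [i₁, i₂, (ℛ k x).eq]
  have hG : toConv (TensorProduct.map s s ∘ₗ (TensorProduct.comm k H H).toLinearMap ∘ₗ
      Coalgebra.comul (R := k)) =
      toConv (i₂.toLinearMap ∘ₗ s) * toConv (i₁.toLinearMap ∘ₗ s) := by
    ext x
    rw [(ℛ k x).convMul_apply]
    simp [i₁, i₂, s, ← (ℛ k x).eq]
  have hinv (i : H →ₐ[k] H ⊗[k] H) : toConv (i.toLinearMap ∘ₗ s) * toConv i.toLinearMap = 1 := by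
    have := LinearMap.algHom_comp_convMul_distrib i (toConv s) (toConv LinearMap.id)
    apply WithConv.ofConv_injective
    refine this.symm.trans ?_
    simp only [s, LinearMap.antipode_mul_id]
    ext x
    simp
  have hleft : toConv (TensorProduct.map s s ∘ₗ (TensorProduct.comm k H H).toLinearMap ∘ₗ
      Coalgebra.comul (R := k)) * toConv (Coalgebra.comul (R := k) (A := H)) = 1 := by
    rw [hδ, hG, mul_assoc, ← mul_assoc _ (toConv i₁.toLinearMap), hinv, one_mul, hinv]
  have := left_inv_eq_right_inv hleft LinearMap.comul_right_inv
  exact LinearMap.congr_fun (congrArg ofConv this.symm) h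

/-- The representation `S(h₂) ⊗ S(h₁)` of the comultiplication of `S(h)`. -/
noncomputable def antipodeRepr {ι : Type*} {h : H} (r : Repr k h ι) :
    Repr k (𝐒 h) ι where
  index := r.index
  left i := 𝐒 (r.right i)
  right i := 𝐒 (r.left i)
  eq := by simp [comul_antipode, ← r.eq]

end Antipode

section Integral

variable {lam : H →ₗ[k] k}

lemma rT_eq_smul_one (hl : ∀ f : H →ₗ[k] k, conv f lam = f 1 • lam) (h : H) :
    rT lam h = lam h • (1 : H) := by
  rw [← sub_eq_zero, ← Module.forall_dual_apply_eq_zero_iff k]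
  intro f
  rw [map_sub, apply_rT, hl]
  simp [mul_comm]

/-- `λ(l₁h)l₂ = λ(lh₁)S(h₂)` for a right integral `λ`. -/
lemma lT_mulRight_eq (hr : ∀ h, lT lam h = lam h • (1 : H)) (h l : H) :
    lT (lam ∘ₗ LinearMap.mulRight k h) l = 𝐒 (lT (lam ∘ₗ LinearMap.mulLeft k l) h) := by
  let P : H →ₗ[k] H := ∑ i ∈ (ℛ k l).index,
    (lam ∘ₗ LinearMap.mulLeft k ((ℛ k l).left i)).smulRight ((ℛ k l).right i)
  let Q : H →ₗ[k] H := (lam ∘ₗ LinearMap.mulLeft k l).smulRight 1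
  have hPQ : toConv P * toConv LinearMap.id = toConv Q := by
    ext x
    have := hr (l * x)
    rw [lT_apply_repr ((ℛ k l).mul (ℛ k x))] at this
    rw [(ℛ k x).convMul_apply]
    simpa [P, Q, Finset.sum_product_right, Finset.sum_mul] using this
  have hP : toConv P = toConv Q * toConv (HopfAlgebra.antipode k) := by
    rw [← hPQ, mul_assoc, LinearMap.id_mul_antipode, mul_one]
  have := congrArg (fun f : WithConv (H →ₗ[k] H) => f h) hP
  rw [(ℛ k h).convMul_apply] at this
  simpa [P, Q, lT_apply_repr (ℛ k l), lT_apply_repr (ℛ k h)] using this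

/-- `λ(hl₂)l₁ = λ(h₂l)S(h₁)` for a left integral `λ`. -/
lemma rT_mulLeft_eq (hl : ∀ h, rT lam h = lam h • (1 : H)) (h l : H) :
    rT (lam ∘ₗ LinearMap.mulLeft k h) l = 𝐒 (rT (lam ∘ₗ LinearMap.mulRight k l) h) := by
  let P : H →ₗ[k] H := ∑ i ∈ (ℛ k l).index,
    (lam ∘ₗ LinearMap.mulRight k ((ℛ k l).right i)).smulRight ((ℛ k l).left i)
  let Q : H →ₗ[k] H := (lam ∘ₗ LinearMap.mulRight k l).smulRight 1
  have hPQ : toConv LinearMap.id * toConv P = toConv Q := by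
    ext x
    have := hl (x * l)
    rw [rT_apply_repr ((ℛ k x).mul (ℛ k l))] at this
    rw [(ℛ k x).convMul_apply]
    simpa [P, Q, Finset.sum_product, Finset.mul_sum] using this
  have hP : toConv P = toConv (HopfAlgebra.antipode k) * toConv Q := by
    rw [← hPQ, ← mul_assoc, LinearMap.antipode_mul_id, one_mul]
  have := congrArg (fun f : WithConv (H →ₗ[k] H) => f h) hP
  rw [(ℛ k h).convMul_apply] at this
  simpa [P, Q, rT_apply_repr (ℛ k l), rT_apply_repr (ℛ k h)] using this

lemma eq_zero_of_lam_rT_mul (hne : lam ≠ 0) (hr : ∀ h, lT lam h = lam h • (1 : H))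
    (hS : Function.Surjective (HopfAlgebra.antipode (R := k) (A := H))) {g : H →ₗ[k] k}
    (hg : ∀ h l, lam (rT g h * l) = 0) : g = 0 := by
  let G : H →ₗ[k] k := g ∘ₗ HopfAlgebra.antipode k
  have hG (h l : H) : lam (h * rT G l) = 0 := by
    have h₁ : lam (rT g h * l) = g (lT (lam ∘ₗ LinearMap.mulRight k l) h) := by
      rw [apply_lT, ← apply_rT]; rfl
    have h₂ : lam (h * rT G l) = G (lT (lam ∘ₗ LinearMap.mulLeft k h) l) := by
      rw [apply_lT, ← apply_rT]; rfl
    rw [h₂, ← hg h l, h₁, lT_mulRight_eq hr]; rfl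
  obtain ⟨t, ht⟩ : ∃ t, lam t ≠ 0 := by
    by_contra! h
    exact hne (LinearMap.ext h)
  ext x
  obtain ⟨y, rfl⟩ := hS x
  have key := HopfAlgebra.mul_antipode_rTensor_comul_apply (R := k) (rT G y)
  rw [comul_rT, ← (ℛ k y).eq, apply_rT, counit_conv] at key
  have hz : lam (t * algebraMap k H (G y)) = 0 := by
    rw [← key]
    simp [Finset.mul_sum, ← mul_assoc, hG]
  rw [Algebra.algebraMap_eq_smul_one, mul_smul_comm, mul_one, map_smul, smul_eq_mul] at hz
  exact (mul_eq_zero.1 hz).resolve_right ht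

end Integral

section Coquasitriangular

variable {σ : (H ⊗[k] H) →ₗ[k] k}

lemma apply_antipode_antipode
    (hσ1 : ∀ h l m : H, σ ((h * l) ⊗ₜ[k] m) =
      conv (σ ∘ₗ (TensorProduct.mk k H H h)) (σ ∘ₗ (TensorProduct.mk k H H l)) m)
    (hσ2 : ∀ h l m : H, σ (h ⊗ₜ[k] (l * m)) =
      conv (σ ∘ₗ ((TensorProduct.mk k H H).flip m)) (σ ∘ₗ ((TensorProduct.mk k H H).flip l)) h)
    (hσ3l : ∀ h : H, σ (h ⊗ₜ[k] (1 : H)) = Coalgebra.counit (R := k) h)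
    (hσ3r : ∀ h : H, σ ((1 : H) ⊗ₜ[k] h) = Coalgebra.counit (R := k) h) (h l : H) :
    σ (𝐒 h ⊗ₜ[k] 𝐒 l) = σ (h ⊗ₜ[k] l) := by
  let s : H →ₗ[k] H := HopfAlgebra.antipode k
  have hleft : toConv σ * toConv (σ ∘ₗ s.rTensor H) = 1 := by
    apply WithConv.ofConv_injective
    ext a b
    have h₁ := HopfAlgebra.sum_mul_antipode_eq_smul (ℛ k a)
    have h₂ := congrArg (fun x => σ (x ⊗ₜ[k] b)) h₁
    simp only [TensorProduct.sum_tmul, map_sum, hσ1, conv_apply_repr (ℛ k b),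
      ← TensorProduct.smul_tmul', map_smul, hσ3r] at h₂
    simpa [((ℛ k a).tmul (ℛ k b)).convMul_apply, Finset.sum_product, s, mul_comm] using h₂
  have hright : toConv (σ ∘ₗ s.rTensor H) * toConv (σ ∘ₗ TensorProduct.map s s) = 1 := by
    apply WithConv.ofConv_injective
    ext a b
    have h₁ := HopfAlgebra.sum_mul_antipode_eq_smul (ℛ k b)
    have h₂ := congrArg (fun y => σ (𝐒 a ⊗ₜ[k] y)) h₁
    simp only [TensorProduct.tmul_sum, map_sum, hσ2, conv_apply_repr (antipodeRepr (ℛ k a)),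
      TensorProduct.tmul_smul, map_smul, hσ3l, counit_antipode] at h₂
    simpa [((ℛ k a).tmul (ℛ k b)).convMul_apply, Finset.sum_product_right, s, antipodeRepr,
      mul_comm] using h₂
  have hσ := WithConv.toConv_injective (left_inv_eq_right_inv hleft hright)
  exact (LinearMap.congr_fun hσ (h ⊗ₜ[k] l)).symm

lemma vF_apply_repr {ι : Type*} {h : H} (r : Repr k h ι) :
    vF σ h = ∑ i ∈ r.index, σ (r.left i ⊗ₜ[k] 𝐒 (r.right i)) := by
  simp [vF, ← r.eq]

lemma uF_apply_repr {ι : Type*} {h : H} (r : Repr k h ι) :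
    uF σ h = ∑ i ∈ r.index, σ (r.right i ⊗ₜ[k] 𝐒 (r.left i)) := by
  simp [uF, ← r.eq]

lemma vF_eq_uF_comp_antipode
    (hσ : ∀ h l : H, σ (𝐒 h ⊗ₜ[k] 𝐒 l) = σ (h ⊗ₜ[k] l)) :
    vF σ = uF σ ∘ₗ (𝐒 : H →ₗ[k] H) := by
  ext h
  rw [LinearMap.comp_apply, uF_apply_repr (antipodeRepr (ℛ k h)), vF_apply_repr (ℛ k h)]
  exact Finset.sum_congr rfl fun i _ => (hσ _ _).symm

lemma lam_lT_vF_mul {lam : H →ₗ[k] k} (hl : ∀ h, rT lam h = lam h • (1 : H))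
    (hr : ∀ h, lT lam h = lam h • (1 : H))
    (hσ4 : ∀ h l : H, ac1 σ (h ⊗ₜ[k] l) = ac2 σ (h ⊗ₜ[k] l)) (h l : H) :
    lam (lT (vF σ) h * l) = lam (l * rT (uF σ) h) := by
  have hv : lam (ac2 σ (h ⊗ₜ[k] l)) = lam (lT (vF σ) h * l) := by
    have h₁ : lam (lT (vF σ) h * l) = vF σ (rT (lam ∘ₗ LinearMap.mulRight k l) h) := by
      rw [apply_rT, ← apply_lT]; rfl
    have h₂ : lam (ac2 σ (h ⊗ₜ[k] l)) = ∑ i ∈ (ℛ k h).index,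
        σ ((ℛ k h).left i ⊗ₜ[k] rT (lam ∘ₗ LinearMap.mulLeft k ((ℛ k h).right i)) l) := by
      simp [ac2, ← (ℛ k h).eq, ← (ℛ k l).eq, TensorProduct.sum_tmul, TensorProduct.tmul_sum,
        rT_apply_repr (ℛ k l), mul_comm]
      exact Finset.sum_comm
    rw [h₁, h₂, vF, LinearMap.comp_apply, LinearMap.comp_apply, comul_rT, ← (ℛ k h).eq]
    simp [rT_mulLeft_eq hl]
  have hu : lam (ac1 σ (h ⊗ₜ[k] l)) = lam (l * rT (uF σ) h) := by
    have h₁ : lam (l * rT (uF σ) h) = uF σ (lT (lam ∘ₗ LinearMap.mulLeft k l) h) := by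
      rw [apply_lT, ← apply_rT]; rfl
    have h₂ : lam (ac1 σ (h ⊗ₜ[k] l)) = ∑ i ∈ (ℛ k h).index,
        σ ((ℛ k h).right i ⊗ₜ[k] lT (lam ∘ₗ LinearMap.mulRight k ((ℛ k h).left i)) l) := by
      simp [ac1, ← (ℛ k h).eq, ← (ℛ k l).eq, TensorProduct.sum_tmul, TensorProduct.tmul_sum,
        lT_apply_repr (ℛ k l), mul_comm]
      exact Finset.sum_comm
    rw [h₁, h₂, uF, LinearMap.comp_apply, LinearMap.comp_apply, LinearMap.comp_apply, comul_lT,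
      ← (ℛ k h).eq]
    simp [lT_mulRight_eq hr]
  rw [← hv, ← hu, hσ4]

end Coquasitriangular

/-- If the modular grouplike $a = 1$, then $u^{-1} * v = u^{-1} * (u∘S) = α$;
in particular $u^{-1} * (u∘S)$ does not depend on $σ$. -/
theorem uinv_conv_v_eq_alpha_of_a_eq_one
    (lam : H →ₗ[k] k) (hlam_ne : lam ≠ 0)
    (hlam_int : ∀ f : H →ₗ[k] k, conv f lam = f 1 • lam)
    (a : H) (ha_ne : a ≠ 0) (ha_grp : Coalgebra.comul (R := k) a = a ⊗ₜ[k] a)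
    (ha_mod : ∀ h : H, lT lam h = lam h • (𝐒 a))
    (ha_S2 : ∀ h : H, lam (𝐒 (𝐒 h)) = lam (a * h * 𝐒 a))
    (Sinv : H →ₗ[k] H) (hSinv_l : ∀ h : H, Sinv (𝐒 h) = h)
    (hSinv_r : ∀ h : H, 𝐒 (Sinv h) = h)
    (α : H →ₐ[k] k)
    (hα : ∀ h l : H, lam (l * h) = lam ((chiMap Sinv α.toLinearMap h) * l))
    (σ : (H ⊗[k] H) →ₗ[k] k)
    (hσ1 : ∀ h l m : H, σ ((h * l) ⊗ₜ[k] m) =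
      conv (σ ∘ₗ (TensorProduct.mk k H H h)) (σ ∘ₗ (TensorProduct.mk k H H l)) m)
    (hσ2 : ∀ h l m : H, σ (h ⊗ₜ[k] (l * m)) =
      conv (σ ∘ₗ ((TensorProduct.mk k H H).flip m)) (σ ∘ₗ ((TensorProduct.mk k H H).flip l)) h)
    (hσ3l : ∀ h : H, σ (h ⊗ₜ[k] (1 : H)) = Coalgebra.counit (R := k) h)
    (hσ3r : ∀ h : H, σ ((1 : H) ⊗ₜ[k] h) = Coalgebra.counit (R := k) h)
    (hσ4 : ∀ h l : H, ac1 σ (h ⊗ₜ[k] l) = ac2 σ (h ⊗ₜ[k] l))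
    (huinv_r : conv (uF σ) (uinvF σ) = Coalgebra.counit (R := k))
    (huinv_l : conv (uinvF σ) (uF σ) = Coalgebra.counit (R := k))
    (hvinv_r : conv (vF σ) (vinvF σ) = Coalgebra.counit (R := k))
    (hvinv_l : conv (vinvF σ) (vF σ) = Coalgebra.counit (R := k))
    (hS2u : ∀ h : H, 𝐒 (𝐒 h) = sw3 (uF σ) LinearMap.id (uinvF σ) h)
    (hS2v : ∀ h : H, 𝐒 (𝐒 h) = sw3 (vinvF σ) LinearMap.id (vF σ) h)
    (ha1 : a = (1 : H)) :
    conv (uinvF σ) (vF σ) = conv (uinvF σ) ((uF σ) ∘ₗ (𝐒 : H →ₗ[k] H)) ∧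
      conv (uinvF σ) ((uF σ) ∘ₗ (𝐒 : H →ₗ[k] H)) = α.toLinearMap := by
  subst ha1
  have hl := rT_eq_smul_one hlam_int
  have hr (h : H) : lT lam h = lam h • (1 : H) := by rw [ha_mod, antipode_one]
  have hvu := vF_eq_uF_comp_antipode (apply_antipode_antipode hσ1 hσ2 hσ3l hσ3r)
  rw [← hvu, and_iff_right rfl]
  set u := uF σ
  set v := vF σ
  set u' := uinvF σ
  set v' := vinvF σ
  simp only [sw3_id] at hS2u hS2v
  have hSinv2 (y : H) : Sinv (Sinv y) = lT v (rT v' y) := by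
    have : 𝐒 (𝐒 (lT v (rT v' y))) = y := by
      rw [hS2v, rT_lT, lT_lT, rT_rT, hvinv_r, rT_counit, lT_counit]
    rw [← hSinv_l (lT v (rT v' y)), ← hSinv_l (𝐒 (lT v (rT v' y))), this]
  have hmul (x l : H) : lam (x * l) = lam (rT (conv v' (conv α.toLinearMap u)) x * l) := by
    have h₁ : lam (lT v (lT v' x) * l) = lam (l * rT u (lT v' x)) :=
      lam_lT_vF_mul hl hr hσ4 (lT v' x) l
    have h₂ (y : H) : chiMap Sinv α.toLinearMap y = Sinv (Sinv (rT α.toLinearMap y)) := by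
      simp [chiMap, rT_apply, ← (ℛ k y).eq]
    rw [lT_lT, hvinv_l, lT_counit, hα _ l, h₂, hSinv2, rT_rT, rT_rT, conv_assoc, rT_lT, lT_lT,
      hvinv_l, lT_counit] at h₁
    exact h₁
  have hone : conv v' (conv α.toLinearMap u) = Coalgebra.counit (R := k) := by
    refine sub_eq_zero.1 (eq_zero_of_lam_rT_mul hlam_ne hr (fun y => ⟨Sinv y, hSinv_r y⟩) ?_)
    intro x l
    have hsub (f g : H →ₗ[k] k) : rT (f - g) x = rT f x - rT g x := by
      simp [rT_apply, LinearMap.lTensor_sub]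
    rw [hsub, rT_counit, sub_mul, map_sub, ← hmul, sub_self]
  have hv : v = conv α.toLinearMap u := by
    rw [← conv_counit v, ← hone, ← conv_assoc, hvinv_r, counit_conv]
  have hcomm : v = conv u (conv v u') := by
    ext x
    have h₁ : v (𝐒 (𝐒 x)) = v x := by
      rw [hS2v, apply_lT, apply_rT, hvinv_l, counit_conv]
    rw [← h₁, hS2u, apply_lT, apply_rT, conv_assoc]
  calc conv u' v = conv u' (conv u (conv v u')) := by rw [← hcomm]
    _ = conv v u' := by rw [← conv_assoc, huinv_l, counit_conv]
    _ = α.toLinearMap := by rw [hv, conv_assoc, huinv_r, conv_counit]
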